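/- Suppose the projected Weiszfeld sequence x_{k+1} = Π_C(T(x_k)) satisfies x_k ∉ {a₁,...,aₘ} for all k ≥ 0. Then the sequence {x_k} converges in norm to the unique optimal solution x̄ of the constrained Fermat-Weber problem min{Σᵢ wᵢ‖x - aᵢ‖ : x ∈ C}. -/

import Mathlib

open Finset Filter
open scoped RealInnerProductSpace Topology

/-- The Weiszfeld operator. -/
noncomputable def weiszfeldT {H : Type*} [NormedAddCommGroup H] [InnerProductSpace ℝ H]
    {m : ℕ} (w : Fin m → ℝ) (a : Fin m → H) (x : H) : H :=
  (∑ i, w i / ‖x - a i‖)⁻¹ • ∑ i, (w i / ‖x - a i‖) • a i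

theorem pw_sum_smul {H : Type*} [NormedAddCommGroup H] [InnerProductSpace ℝ H]
    {m : ℕ} (hm : 1 ≤ m) (a : Fin m → H) (w : Fin m → ℝ) (hw : ∀ i, 0 < w i)
    (x : H) (hx : x ∉ Set.range a) (q : H) :
    0 < ∑ i, w i / ‖x - a i‖ ∧
    (∑ i, w i / ‖x - a i‖) • (weiszfeldT w a x - q) = ∑ i, (w i / ‖x - a i‖) • (a i - q) := by
  have hpos : ∀ i, 0 < w i / ‖x - a i‖ := fun i =>
    div_pos (hw i) (norm_pos_iff.2 (sub_ne_zero.2 fun h => hx ⟨i, h.symm⟩))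
  have hs : 0 < ∑ i, w i / ‖x - a i‖ :=
    Finset.sum_pos (fun i _ => hpos i) ⟨⟨0, hm⟩, Finset.mem_univ _⟩
  refine ⟨hs, ?_⟩
  simp only [smul_sub, weiszfeldT, Finset.sum_sub_distrib, ← Finset.sum_smul]
  rw [smul_inv_smul₀ hs.ne']

theorem pw_key {H : Type*} [NormedAddCommGroup H] [InnerProductSpace ℝ H]
    {m : ℕ} (hm : 1 ≤ m) (a : Fin m → H) (w : Fin m → ℝ) (hw : ∀ i, 0 < w i)
    (x : H) (hx : x ∉ Set.range a) (y p : H)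
    (hp : ⟪weiszfeldT w a x - p, y - p⟫ ≤ 0) :
    ∑ i, w i * ‖p - a i‖ - ∑ i, w i * ‖y - a i‖ ≤
      (∑ i, w i / ‖x - a i‖) / 2 * (‖y - x‖ ^ 2 - ‖y - p‖ ^ 2) := by
  obtain ⟨hs, hT⟩ := pw_sum_smul hm a w hw x hx p
  have h1 : ∑ i, (w i / ‖x - a i‖) * ⟪a i - p, y - p⟫ ≤ 0 := by
    have : ∑ i, (w i / ‖x - a i‖) * ⟪a i - p, y - p⟫
        = (∑ i, w i / ‖x - a i‖) * ⟪weiszfeldT w a x - p, y - p⟫ := by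
      rw [← real_inner_smul_left, hT, sum_inner]
      simp only [real_inner_smul_left]
    rw [this]
    exact mul_nonpos_of_nonneg_of_nonpos hs.le hp
  have h2 : ∀ i, w i * ‖p - a i‖ - w i * ‖y - a i‖ ≤
      (w i / ‖x - a i‖) / 2 * (‖y - x‖ ^ 2 - ‖y - p‖ ^ 2)
        + (w i / ‖x - a i‖) * ⟪a i - p, y - p⟫ := by
    intro i
    have hn : 0 < ‖x - a i‖ := norm_pos_iff.2 (sub_ne_zero.2 fun h => hx ⟨i, h.symm⟩)
    have hc : 0 < w i / ‖x - a i‖ := div_pos (hw i) hn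
    have hwc : w i = w i / ‖x - a i‖ * ‖x - a i‖ := by field_simp
    set c := w i / ‖x - a i‖
    have e1 : ‖y - x‖ ^ 2 = ‖y - a i‖ ^ 2 - 2 * ⟪y - a i, x - a i⟫ + ‖x - a i‖ ^ 2 := by
      rw [← norm_sub_sq_real]; congr 2; abel
    have e2 : ‖y - a i‖ ^ 2 = ‖y - p‖ ^ 2 - 2 * ⟪y - p, a i - p⟫ + ‖a i - p‖ ^ 2 := by
      rw [← norm_sub_sq_real]; congr 2; abel
    rw [real_inner_comm (y - p) (a i - p)] 
    rw [norm_sub_rev (a i) p] at e2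
    have e3 := real_inner_le_norm (y - a i) (x - a i)
    rw [hwc]
    have : ‖x - a i‖ * ‖p - a i‖ - ‖x - a i‖ * ‖y - a i‖ ≤
      1 / 2 * (‖y - x‖ ^ 2 - ‖y - p‖ ^ 2) + ⟪y - p, a i - p⟫ := by
      nlinarith [sq_nonneg (‖x - a i‖ - ‖p - a i‖)]
    nlinarith
  calc _ = ∑ i, (w i * ‖p - a i‖ - w i * ‖y - a i‖) := by rw [Finset.sum_sub_distrib]
    _ ≤ _ := Finset.sum_le_sum fun i _ => h2 i
    _ = (∑ i, w i / ‖x - a i‖) / 2 * (‖y - x‖ ^ 2 - ‖y - p‖ ^ 2)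
        + ∑ i, (w i / ‖x - a i‖) * ⟪a i - p, y - p⟫ := by
      rw [Finset.sum_add_distrib, Finset.sum_div, Finset.sum_mul]
    _ ≤ _ := by linarith

theorem pw_unique {H : Type*} [NormedAddCommGroup H] [InnerProductSpace ℝ H]
    {m : ℕ} (a : Fin m → H) (w : Fin m → ℝ) (hw : ∀ i, 0 < w i)
    (hcol : ¬ ∃ u v : H, ∀ i, ∃ t : ℝ, a i = u + t • v)
    (C : Set H) (hCconv : Convex ℝ C) (y b : H) (hy : y ∈ C) (hb : b ∈ C)
    (hym : IsMinOn (fun x => ∑ i, w i * ‖x - a i‖) C y)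
    (hbm : IsMinOn (fun x => ∑ i, w i * ‖x - a i‖) C b) : y = b := by
  by_contra hne
  apply hcol
  refine ⟨y, b - y, ?_⟩
  have hmid : (1 / 2 : ℝ) • y + (1 / 2 : ℝ) • b ∈ C :=
    hCconv hy hb (by norm_num) (by norm_num) (by norm_num)
  have h1 := isMinOn_iff.1 hym _ hmid
  have h2 := isMinOn_iff.1 hbm _ hmid
  have hn : ∀ i, ‖(1 / 2 : ℝ) • y + (1 / 2 : ℝ) • b - a i‖ = 1 / 2 * ‖(y - a i) + (b - a i)‖ := by
    intro i
    rw [← Real.norm_of_nonneg (by norm_num : (0 : ℝ) ≤ 1 / 2), ← norm_smul]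
    congr 1
    rw [Real.norm_of_nonneg (by norm_num : (0 : ℝ) ≤ 1 / 2)]
    module
  simp only [hn] at h1 h2
  have hle : ∀ i ∈ Finset.univ, w i * (1 / 2 * ‖(y - a i) + (b - a i)‖) ≤
      1 / 2 * (w i * ‖y - a i‖) + 1 / 2 * (w i * ‖b - a i‖) := by
    intro i _
    have := norm_add_le (y - a i) (b - a i)
    nlinarith [hw i]
  have heq := (Finset.sum_eq_sum_iff_of_le hle).1 (by
    apply le_antisymm (Finset.sum_le_sum hle)
    rw [Finset.sum_add_distrib, ← Finset.mul_sum, ← Finset.mul_sum]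
    linarith)
  intro i
  have hi := heq i (Finset.mem_univ _)
  have hsr : SameRay ℝ (y - a i) (b - a i) := by
    rw [sameRay_iff_norm_add]
    apply mul_left_cancel₀ (hw i).ne'
    linarith
  rcases hsr with h | h | ⟨r₁, r₂, h1, h2, h⟩
  · exact ⟨0, by simp [sub_eq_zero.1 h]⟩
  · exact ⟨1, by simp [sub_eq_zero.1 h]⟩
  · have hr : r₁ - r₂ ≠ 0 := by
      intro h0
      have : r₁ = r₂ := by linarith
      subst this
      have := smul_right_injective H h1.ne' h
      exact hne (sub_left_injective this)
    refine ⟨-r₂ / (r₁ - r₂), ?_⟩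
    apply smul_right_injective H hr
    simp only [smul_add, smul_smul]
    rw [mul_div_cancel₀ _ hr]
    have h' : r₁ • y - r₁ • a i = r₂ • b - r₂ • a i := by simpa [smul_sub] using h
    have h'' : r₁ • a i = r₁ • y - r₂ • b + r₂ • a i := by
      rw [sub_eq_iff_eq_add] at h'
      rw [h']; abel
    rw [sub_smul, h'']
    module

theorem pw_opt {H : Type*} [NormedAddCommGroup H] [InnerProductSpace ℝ H]
    {m : ℕ} (hm : 1 ≤ m) (a : Fin m → H) (w : Fin m → ℝ) (hw : ∀ i, 0 < w i)
    (C : Set H) (proj : H → H)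
    (hproj : ∀ x : H, proj x ∈ C ∧ ∀ z ∈ C, ⟪x - proj x, z - proj x⟫ ≤ 0)
    (xseq : ℕ → H)
    (hrec : ∀ k, xseq (k + 1) = proj (weiszfeldT w a (xseq k)))
    (hA : ∀ k, xseq k ∉ Set.range a) (b : H)
    (hF : ∀ k, ‖xseq (k + 1) - b‖ ≤ ‖xseq k - b‖)
    (hlim : Tendsto xseq atTop (𝓝 b)) :
    IsMinOn (fun x => ∑ i, w i * ‖x - a i‖) C b := by
  classical
  rw [isMinOn_iff]
  intro z hz
  set d := z - b with hd
  have hu : Tendsto (fun k => ‖xseq (k + 1) - b‖) atTop (𝓝 0) := by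
    have := (((tendsto_add_atTop_iff_nat 1).2 hlim).sub_const b).norm
    simpa using this
  have hx0 : Tendsto (fun k => ‖xseq k - b‖) atTop (𝓝 0) := by
    have := (hlim.sub_const b).norm
    simpa using this
  -- convergence of the gradient-like vectors
  have hR : Tendsto (fun k => ∑ i, (w i / ‖xseq k - a i‖) • (a i - b)) atTop
      (𝓝 (∑ i, (w i / ‖b - a i‖) • (a i - b))) := by
    apply tendsto_finsetSum
    intro i _
    by_cases h : a i = b
    · simp [h]
    · apply Tendsto.smul_const
      apply Tendsto.div tendsto_const_nhds ((hlim.sub_const _).norm)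
      exact norm_ne_zero_iff.2 (sub_ne_zero.2 (Ne.symm h))
  have hW : Tendsto (fun k => ∑ i, (w i / ‖xseq k - a i‖) * ‖xseq k - b‖) atTop
      (𝓝 (∑ i, if a i = b then w i else 0)) := by
    apply tendsto_finsetSum
    intro i _
    by_cases h : a i = b
    · simp only [h, if_true]
      refine tendsto_const_nhds.congr fun k => ?_
      have : ‖xseq k - b‖ ≠ 0 :=
        norm_ne_zero_iff.2 (sub_ne_zero.2 fun h' => hA k ⟨i, h.trans h'.symm⟩)
      field_simp
    · simp only [h, if_false]
      have h1 : Tendsto (fun k => w i / ‖xseq k - a i‖) atTop (𝓝 (w i / ‖b - a i‖)) :=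
        Tendsto.div tendsto_const_nhds ((hlim.sub_const _).norm)
          (norm_ne_zero_iff.2 (sub_ne_zero.2 (Ne.symm h)))
      simpa using h1.mul hx0
  have hineq : ∀ k, ⟪∑ i, (w i / ‖xseq k - a i‖) • (a i - b), d⟫ ≤
      (∑ i, (w i / ‖xseq k - a i‖) * ‖xseq k - b‖) * ‖d‖ +
        ‖∑ i, (w i / ‖xseq k - a i‖) • (a i - b)‖ * ‖xseq (k + 1) - b‖ := by
    intro k
    obtain ⟨hs, hT⟩ := pw_sum_smul hm a w hw (xseq k) (hA k) b
    rw [← hT, ← Finset.sum_mul, norm_smul, Real.norm_of_nonneg hs.le, real_inner_smul_left]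
    set s := ∑ i, w i / ‖xseq k - a i‖
    have hp := (hproj (weiszfeldT w a (xseq k))).2 z hz
    rw [← hrec k] at hp
    have e1 : weiszfeldT w a (xseq k) - xseq (k + 1)
        = (weiszfeldT w a (xseq k) - b) - (xseq (k + 1) - b) := by abel
    have e2 : z - xseq (k + 1) = d - (xseq (k + 1) - b) := by rw [hd]; abel
    rw [e1, e2] at hp
    have hFk := hF k
    set v := weiszfeldT w a (xseq k) - b
    set u := xseq (k + 1) - b
    simp only [inner_sub_left, inner_sub_right] at hp
    have i1 := real_inner_le_norm v u
    have i2 := real_inner_le_norm u d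
    have i3 : (0 : ℝ) ≤ ⟪u, u⟫ := real_inner_self_nonneg
    have i4 : ‖u‖ * ‖d‖ ≤ ‖xseq k - b‖ * ‖d‖ := by gcongr
    have : ⟪v, d⟫ ≤ ‖xseq k - b‖ * ‖d‖ + ‖v‖ * ‖u‖ := by linarith
    nlinarith
  have hfin := le_of_tendsto_of_tendsto' (hR.inner tendsto_const_nhds)
    ((hW.mul_const ‖d‖).add (hR.norm.mul hu)) hineq
  rw [mul_zero, add_zero, sum_inner, Finset.sum_mul] at hfin
  have hterm : ∀ i, w i * ‖b - a i‖ + (if a i = b then w i else 0) * ‖d‖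
      - ⟪(w i / ‖b - a i‖) • (a i - b), d⟫ ≤ w i * ‖z - a i‖ := by
    intro i
    by_cases h : a i = b
    · simp [h, hd]
    · have hn : 0 < ‖b - a i‖ := norm_pos_iff.2 (sub_ne_zero.2 (Ne.symm h))
      simp only [h, if_false, zero_mul, add_zero, real_inner_smul_left]
      have hc : 0 < w i / ‖b - a i‖ := div_pos (hw i) hn
      have hwc : w i = w i / ‖b - a i‖ * ‖b - a i‖ := by field_simp
      set c := w i / ‖b - a i‖
      rw [hwc]
      have e1 := real_inner_le_norm (b - a i) (z - a i)
      have e2 : ⟪a i - b, d⟫ = ‖b - a i‖ ^ 2 - ⟪b - a i, z - a i⟫ := by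
        have : d = (z - a i) - (b - a i) := by rw [hd]; abel
        rw [this, ← neg_sub b (a i), inner_neg_left, inner_sub_right,
          real_inner_self_eq_norm_sq]
        ring
      rw [e2]
      nlinarith
  have := Finset.sum_le_sum fun i (_ : i ∈ Finset.univ) => hterm i
  rw [Finset.sum_sub_distrib, Finset.sum_add_distrib] at this
  linarith

theorem projected_weiszfeld_converges
    {H : Type*} [NormedAddCommGroup H] [InnerProductSpace ℝ H] [CompleteSpace H]
    {m : ℕ} (hm : 1 ≤ m) (a : Fin m → H) (w : Fin m → ℝ) (hw : ∀ i, 0 < w i)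
    (hcol : ¬ ∃ u v : H, ∀ i, ∃ t : ℝ, a i = u + t • v)
    (C : Set H) (hCne : C.Nonempty) (hCclosed : IsClosed C) (hCconv : Convex ℝ C)
    (proj : H → H)
    (hproj : ∀ x : H, proj x ∈ C ∧ ∀ z ∈ C, ⟪x - proj x, z - proj x⟫ ≤ 0)
    (xseq : ℕ → H) (hx0 : xseq 0 ∈ C)
    (hrec : ∀ k, xseq (k + 1) = proj (weiszfeldT w a (xseq k)))
    (hA : ∀ k, xseq k ∉ Set.range a) :
    ∃ xbar : H, (xbar ∈ C ∧ IsMinOn (fun x => ∑ i, w i * ‖x - a i‖) C xbar) ∧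
      (∀ y : H, y ∈ C → IsMinOn (fun x => ∑ i, w i * ‖x - a i‖) C y → y = xbar) ∧
      Tendsto xseq atTop (𝓝 xbar) := by
  set f : H → ℝ := fun x => ∑ i, w i * ‖x - a i‖ with hf
  have hfc : Continuous f := by fun_prop
  have hxC : ∀ k, xseq k ∈ C := by
    intro k
    cases k with
    | zero => exact hx0
    | succ k => rw [hrec]; exact (hproj _).1
  have hkey : ∀ k, ∀ y ∈ C, f (xseq (k + 1)) - f y ≤
      (∑ i, w i / ‖xseq k - a i‖) / 2 * (‖y - xseq k‖ ^ 2 - ‖y - xseq (k + 1)‖ ^ 2) := by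
    intro k y hy
    apply pw_key hm a w hw _ (hA k)
    rw [hrec]
    exact (hproj _).2 y hy
  have hspos : ∀ k, 0 < ∑ i, w i / ‖xseq k - a i‖ := fun k =>
    (pw_sum_smul hm a w hw _ (hA k) 0).1
  have hanti : Antitone fun k => f (xseq k) := by
    apply antitone_nat_of_succ_le
    intro k
    have h := hkey k _ (hxC k)
    rw [sub_self, norm_zero] at h
    have := hspos k
    nlinarith [mul_nonneg this.le (sq_nonneg ‖xseq k - xseq (k + 1)‖)]
  have hpc : LipschitzWith 1 proj := by
    apply LipschitzWith.of_dist_le_mul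
    intro x y
    rw [dist_eq_norm, dist_eq_norm, NNReal.coe_one, one_mul]
    have h1 := (hproj x).2 _ (hproj y).1
    have h2 := (hproj y).2 _ (hproj x).1
    have h3 := real_inner_le_norm (x - y) (proj x - proj y)
    have h4 : ⟪x - y, proj x - proj y⟫ = ‖proj x - proj y‖ ^ 2
        - ⟪x - proj x, proj y - proj x⟫ - ⟪y - proj y, proj x - proj y⟫ := by
      rw [← real_inner_self_eq_norm_sq]
      simp only [inner_sub_left, inner_sub_right]
      ring
    by_contra! hlt
    have h5 : 0 < ‖proj x - proj y‖ := lt_of_le_of_lt (norm_nonneg _) hlt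
    nlinarith
  have hK : IsCompact (proj '' convexHull ℝ (Set.range a)) :=
    ((Set.finite_range a).isCompact_convexHull ℝ).image hpc.continuous
  have hmem : ∀ k, xseq (k + 1) ∈ proj '' convexHull ℝ (Set.range a) := by
    intro k
    rw [hrec]
    refine ⟨_, ?_, rfl⟩
    have hs := hspos k
    rw [weiszfeldT, Finset.smul_sum]
    simp only [smul_smul]
    refine (convex_convexHull ℝ (Set.range a)).sum_mem (fun i _ => ?_) ?_
      (fun i _ => subset_convexHull ℝ _ ⟨i, rfl⟩)
    · exact mul_nonneg (inv_nonneg.2 hs.le) (div_nonneg (hw i).le (norm_nonneg _))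
    · rw [← Finset.mul_sum, inv_mul_cancel₀ hs.ne']
  obtain ⟨b, -, φ, hφ, hb⟩ := hK.tendsto_subseq hmem
  have hb' : Tendsto (fun n => xseq (φ n + 1)) atTop (𝓝 b) := hb
  have hφ1 : Tendsto (fun n => φ n + 1) atTop atTop :=
    (tendsto_add_atTop_nat 1).comp hφ.tendsto_atTop
  have hbC : b ∈ C := hCclosed.mem_of_tendsto hb' (Eventually.of_forall fun n => hxC _)
  have hfb : ∀ k, f b ≤ f (xseq k) := by
    intro k
    refine le_of_tendsto ((hfc.tendsto b).comp hb') ?_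
    filter_upwards [hφ1.eventually_ge_atTop k] with n hn
    exact hanti hn
  have hF : ∀ k, ‖xseq (k + 1) - b‖ ≤ ‖xseq k - b‖ := by
    intro k
    have h := hkey k b hbC
    rw [norm_sub_rev b, norm_sub_rev b] at h
    have h1 := hfb (k + 1)
    have h2 := hspos k
    have h3 : 0 ≤ ‖xseq k - b‖ ^ 2 - ‖xseq (k + 1) - b‖ ^ 2 := by
      by_contra! hlt
      nlinarith
    exact (sq_le_sq₀ (norm_nonneg _) (norm_nonneg _)).1 (by linarith)
  have hlim : Tendsto xseq atTop (𝓝 b) := by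
    rw [tendsto_iff_norm_sub_tendsto_zero]
    have hd := tendsto_iff_norm_sub_tendsto_zero.1 hb'
    exact (tendsto_iff_tendsto_subseq_of_antitone (antitone_nat_of_succ_le hF) hφ1).2 hd
  have hmin := pw_opt hm a w hw C proj hproj xseq hrec hA b hF hlim
  exact ⟨b, ⟨hbC, hmin⟩, fun y hy hym => pw_unique a w hw hcol C hCconv y b hy hbC hym hmin, hlim⟩
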